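/- arXiv:2008.06036 — 6 statements merged into one kernel-verified Lean document; each statement's English description precedes it below -/
import Mathlib

section
/- Let μ ∈ ℝ, σ > 0 and t ∈ ℝ with t ≤ μ + σ. If X is a real Gaussian random variable with mean μ and variance σ², then P(X > t) ≥ 1/(2·√(2πe)). -/
open MeasureTheory ProbabilityTheory

lemma hasDerivAt_neg_exp_neg_sq_div {x : ℝ} (hx : x ≠ 0) :
    HasDerivAt (fun y : ℝ ↦ -(Real.exp (-y ^ 2 / 2) / y))
      ((1 + 1 / x ^ 2) * Real.exp (-x ^ 2 / 2)) x := by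
  have h : HasDerivAt (fun y : ℝ ↦ -y ^ 2 / 2) (-x) x :=
    ((hasDerivAt_pow 2 x).neg.div_const 2).congr_deriv (by norm_num; ring)
  refine (h.exp.div (hasDerivAt_id x) hx).neg.congr_deriv ?_
  simp only [id]
  field_simp
  ring

lemma tendsto_neg_exp_neg_sq_div_atTop :
    Filter.Tendsto (fun y : ℝ ↦ -(Real.exp (-y ^ 2 / 2) / y)) Filter.atTop (nhds 0) := by
  rw [← neg_zero]
  refine Filter.Tendsto.neg (squeeze_zero' ?_ ?_ tendsto_inv_atTop_zero)
  · filter_upwards [Filter.eventually_gt_atTop 0] with y hy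
    positivity
  · filter_upwards [Filter.eventually_gt_atTop 0] with y hy
    rw [div_eq_mul_inv]
    refine mul_le_of_le_one_left (by positivity) (Real.exp_le_one_iff.2 ?_)
    nlinarith [sq_nonneg y]

lemma exp_neg_half_div_two_le_integral_Ioi :
    Real.exp (-1 / 2) / 2 ≤ ∫ x in Set.Ioi (1 : ℝ), Real.exp (-x ^ 2 / 2) := by
  have hderiv : ∀ x ∈ Set.Ici (1 : ℝ), HasDerivAt (fun y : ℝ ↦ -(Real.exp (-y ^ 2 / 2) / y))
      ((1 + 1 / x ^ 2) * Real.exp (-x ^ 2 / 2)) x := fun x hx ↦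
    hasDerivAt_neg_exp_neg_sq_div (zero_lt_one.trans_le hx).ne'
  have hnonneg : ∀ x ∈ Set.Ioi (1 : ℝ), 0 ≤ (1 + 1 / x ^ 2) * Real.exp (-x ^ 2 / 2) :=
    fun x _ ↦ by positivity
  have hint := integrableOn_Ioi_deriv_of_nonneg' hderiv hnonneg tendsto_neg_exp_neg_sq_div_atTop
  have heq := integral_Ioi_of_hasDerivAt_of_nonneg' hderiv hnonneg tendsto_neg_exp_neg_sq_div_atTop
  have hexp : Integrable (fun x : ℝ ↦ Real.exp (-x ^ 2 / 2)) := by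
    convert integrable_exp_neg_mul_sq (b := 1 / 2) (by norm_num) using 3
    ring
  have hle := setIntegral_mono_on hint (hexp.integrableOn.const_mul 2) measurableSet_Ioi
    fun x (hx : 1 < x) ↦ by
      have : 1 / x ^ 2 ≤ 1 := by
        rw [div_le_one (by positivity)]
        nlinarith
      gcongr
      linarith
  rw [heq, integral_const_mul] at hle
  norm_num at hle ⊢
  linarith

lemma one_div_le_gaussianReal_Ioi_one :
    1 / (2 * Real.sqrt (2 * Real.pi * Real.exp 1)) ≤ (gaussianReal 0 1).real (Set.Ioi 1) := by
  rw [measureReal_def, gaussianReal_apply_eq_integral _ one_ne_zero, ENNReal.toReal_ofReal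
    (integral_nonneg fun x ↦ gaussianPDFReal_nonneg _ _ _)]
  simp only [gaussianPDFReal, NNReal.coe_one, mul_one, sub_zero, integral_const_mul]
  refine le_trans (le_of_eq ?_) (mul_le_mul_of_nonneg_left exp_neg_half_div_two_le_integral_Ioi
    (by positivity))
  rw [Real.sqrt_mul (by positivity), ← Real.exp_half, neg_div, Real.exp_neg]
  field_simp

lemma gaussianReal_real_Ioi_add_std (μ : ℝ) {σ : ℝ} (hσ : 0 < σ) :
    (gaussianReal μ (Real.toNNReal (σ ^ 2))).real (Set.Ioi (μ + σ)) =
      (gaussianReal 0 1).real (Set.Ioi 1) := by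
  have hmap : gaussianReal μ (Real.toNNReal (σ ^ 2)) =
      ((gaussianReal 0 1).map (σ * ·)).map (μ + ·) := by
    rw [gaussianReal_map_const_mul, gaussianReal_map_const_add]
    congr 1
    · simp
    · ext
      simp [sq_nonneg]
  rw [hmap, map_measureReal_apply (by fun_prop) measurableSet_Ioi,
    map_measureReal_apply (by fun_prop) (by measurability)]
  congr 1
  ext x
  simp [hσ.ne', ← div_lt_iff₀' hσ]

/-- Gaussian anticoncentration: if `X ~ N(μ, σ²)` and `t ≤ μ + σ`, then
`P(X > t) ≥ 1/(2√(2πe))`. -/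
theorem gaussian_anticoncentration
    {Ω : Type*} [MeasurableSpace Ω] (P : Measure Ω) [IsProbabilityMeasure P]
    (μ σ t : ℝ) (hσ : 0 < σ) (ht : t ≤ μ + σ)
    (X : Ω → ℝ)
    (hX : Measure.map X P = gaussianReal μ (Real.toNNReal (σ ^ 2))) :
    1 / (2 * Real.sqrt (2 * Real.pi * Real.exp 1)) ≤ (P {ω | t < X ω}).toReal := by
  have hXm : AEMeasurable X P :=
    AEMeasurable.of_map_ne_zero (hX ▸ IsProbabilityMeasure.ne_zero _)
  calc 1 / (2 * Real.sqrt (2 * Real.pi * Real.exp 1))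
      ≤ (gaussianReal 0 1).real (Set.Ioi 1) := one_div_le_gaussianReal_Ioi_one
    _ = (gaussianReal μ (Real.toNNReal (σ ^ 2))).real (Set.Ioi (μ + σ)) :=
      (gaussianReal_real_Ioi_add_std μ hσ).symm
    _ ≤ (gaussianReal μ (Real.toNNReal (σ ^ 2))).real (Set.Ioi t) :=
      measureReal_mono (Set.Ioi_subset_Ioi ht)
    _ = (P {ω | t < X ω}).toReal := by
      rw [← hX, measureReal_def, Measure.map_apply_of_aemeasurable hXm measurableSet_Ioi]
      rfl
end

section
/- Let m ≥ 1 be an integer, let D ⊆ ℝ^m be a finite nonempty set, and let x ∈ ℝ^m. Let ξ and ξ' be independent, identically distributed, integrable random vectors in ℝ^m, and let d̃ = f(ξ) where f : ℝ^m → D is a measurable function satisfying ⟨f(z), x + z⟩ = max_{d ∈ D} ⟨d, x + z⟩ for every z ∈ ℝ^m (a measurable argmax selection). Then E[(⟨d̃, x + ξ⟩ − E[⟨d̃, x + ξ⟩])⁺] ≤ E[|⟨d̃, ξ⟩|] + E[|⟨d̃, ξ'⟩|], where for y ∈ ℝ, y⁺ = max(y, 0). -/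
open Matrix MeasureTheory ProbabilityTheory

/-- Fubini for independent random variables: the two arguments may be integrated separately. -/
lemma integral_comp_prodMk_of_indepFun {Ω E F : Type*} [MeasurableSpace Ω] [MeasurableSpace E]
    [MeasurableSpace F] {P : Measure Ω} [IsProbabilityMeasure P] {X : Ω → E} {Y : Ω → F}
    (hX : Measurable X) (hY : Measurable Y) (hXY : IndepFun X Y P) {h : E × F → ℝ}
    (hh : Measurable h) (hint : Integrable (fun ω => h (X ω, Y ω)) P) :
    Integrable (fun ω => ∫ ω', h (X ω, Y ω') ∂P) P ∧
      ∫ ω, ∫ ω', h (X ω, Y ω') ∂P ∂P = ∫ ω, h (X ω, Y ω) ∂P := by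
  have := Measure.isProbabilityMeasure_map (μ := P) hX.aemeasurable
  have := Measure.isProbabilityMeasure_map (μ := P) hY.aemeasurable
  have hmap := (indepFun_iff_map_prod_eq_prod_map_map hX.aemeasurable hY.aemeasurable).1 hXY
  have hprod : Integrable h ((P.map X).prod (P.map Y)) := by
    rw [← hmap]
    exact (integrable_map_measure hh.aestronglyMeasurable (hX.prodMk hY).aemeasurable).2 hint
  have hinner : ∀ z, ∫ y, h (z, y) ∂(P.map Y) = ∫ ω', h (z, Y ω') ∂P := fun z =>
    integral_map hY.aemeasurable (hh.comp measurable_prodMk_left).aestronglyMeasurable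
  have hleft := hprod.integral_prod_left
  have hsplit := integral_prod h hprod
  rw [← hmap, integral_map (hX.prodMk hY).aemeasurable hh.aestronglyMeasurable] at hsplit
  rw [integral_map hX.aemeasurable hleft.aestronglyMeasurable] at hsplit
  have hcomp := hleft.comp_measurable hX
  simp only [Function.comp_def, hinner] at hcomp hsplit
  exact ⟨hcomp, hsplit.symm⟩

/-- Dot products against a finite set of vectors are uniformly bounded by a multiple of the norm. -/
lemma exists_abs_dotProduct_le {m : ℕ} (D : Finset (Fin m → ℝ)) :
    ∃ C : ℝ, ∀ d ∈ D, ∀ y : Fin m → ℝ, |d ⬝ᵥ y| ≤ C * ‖y‖ := by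
  refine ⟨∑ d ∈ D, ∑ i, |d i|, fun d hd y => ?_⟩
  calc |d ⬝ᵥ y| ≤ ∑ i, |d i * y i| := Finset.abs_sum_le_sum_abs _ _
    _ ≤ ∑ i, |d i| * ‖y‖ := Finset.sum_le_sum fun i _ => by
        rw [abs_mul]
        exact mul_le_mul_of_nonneg_left (norm_le_pi_norm y i) (abs_nonneg _)
    _ = (∑ i, |d i|) * ‖y‖ := (Finset.sum_mul _ _ _).symm
    _ ≤ _ := mul_le_mul_of_nonneg_right
        (Finset.single_le_sum (f := fun d : Fin m → ℝ => ∑ i, |d i|)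
          (fun _ _ => Finset.sum_nonneg fun _ _ => abs_nonneg _) hd) (norm_nonneg _)

/-- Symmetrization lemma for Thompson sampling (Lemma 5, with trivial conditioning):
if `d̃ = f(ξ)` is a measurable argmax selection over a finite set `D` of the perturbed
objective `⟨d, x + ξ⟩`, and `ξ'` is an independent copy of `ξ`, then
`E[(⟨d̃, x+ξ⟩ − E⟨d̃, x+ξ⟩)⁺] ≤ E|⟨d̃, ξ⟩| + E|⟨d̃, ξ'⟩|`. -/
theorem ts_symmetrization
    {Ω : Type*} [MeasurableSpace Ω] (P : Measure Ω) [IsProbabilityMeasure P]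
    (m : ℕ) (hm : 1 ≤ m)
    (D : Finset (Fin m → ℝ)) (hD : D.Nonempty)
    (x : Fin m → ℝ)
    (ξ ξ' : Ω → Fin m → ℝ)
    (hξmeas : Measurable ξ) (hξ'meas : Measurable ξ')
    (hξint : Integrable ξ P) (hξ'int : Integrable ξ' P)
    (hid : IdentDistrib ξ ξ' P P)
    (hindep : IndepFun ξ ξ' P)
    (f : (Fin m → ℝ) → (Fin m → ℝ)) (hfmeas : Measurable f)
    (hfD : ∀ z, f z ∈ D)
    (hfmax : ∀ z, ∀ d ∈ D, d ⬝ᵥ (x + z) ≤ f z ⬝ᵥ (x + z))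
    (dtil : Ω → Fin m → ℝ) (hdtil : ∀ ω, dtil ω = f (ξ ω)) :
    ∫ ω, max (dtil ω ⬝ᵥ (x + ξ ω) - ∫ ω', dtil ω' ⬝ᵥ (x + ξ ω') ∂P) 0 ∂P ≤
      (∫ ω, |dtil ω ⬝ᵥ ξ ω| ∂P) + ∫ ω, |dtil ω ⬝ᵥ ξ' ω| ∂P := by
  obtain rfl : dtil = fun ω => f (ξ ω) := funext hdtil
  obtain ⟨C, hC⟩ := exists_abs_dotProduct_le D
  have hdot : Measurable fun p : (Fin m → ℝ) × (Fin m → ℝ) => p.1 ⬝ᵥ p.2 := by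
    unfold dotProduct
    fun_prop
  have hint : ∀ (g η : Ω → Fin m → ℝ), Measurable g → (∀ ω, g ω ∈ D) → Measurable η →
      Integrable η P → Integrable (fun ω => g ω ⬝ᵥ η ω) P := fun g η hg hgD hη hηi =>
    (hηi.norm.const_mul C).mono' (hdot.comp (hg.prodMk hη)).aestronglyMeasurable
      (.of_forall fun ω => hC _ (hgD ω) _)
  have hvalue : Measurable fun z => f z ⬝ᵥ (x + z) :=
    hdot.comp (hfmeas.prodMk (measurable_id.const_add x))
  have hcopy : ∫ ω, f (ξ ω) ⬝ᵥ (x + ξ ω) ∂P = ∫ ω, f (ξ' ω) ⬝ᵥ (x + ξ' ω) ∂P :=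
    (hid.comp hvalue).integral_eq
  have hvalue_int : Integrable (fun ω => f (ξ ω) ⬝ᵥ (x + ξ ω)) P :=
    hint _ _ (hfmeas.comp hξmeas) (fun _ => hfD _) (hξmeas.const_add x)
      ((integrable_const x).add hξint)
  have hvalue_int' : Integrable (fun ω => f (ξ' ω) ⬝ᵥ (x + ξ' ω)) P :=
    hint _ _ (hfmeas.comp hξ'meas) (fun _ => hfD _) (hξ'meas.const_add x)
      ((integrable_const x).add hξ'int)
  have hself : Integrable (fun ω => |f (ξ ω) ⬝ᵥ ξ ω|) P :=
    (hint _ _ (hfmeas.comp hξmeas) (fun _ => hfD _) hξmeas hξint).abs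
  have hcross : Integrable (fun ω => |f (ξ ω) ⬝ᵥ ξ' ω|) P :=
    (hint _ _ (hfmeas.comp hξmeas) (fun _ => hfD _) hξ'meas hξ'int).abs
  have habs : Measurable fun p : (Fin m → ℝ) × (Fin m → ℝ) => |f p.1 ⬝ᵥ p.2| :=
    measurable_abs.comp (hdot.comp ((hfmeas.comp measurable_fst).prodMk measurable_snd))
  obtain ⟨hfub_int, hfub⟩ :=
    integral_comp_prodMk_of_indepFun hξmeas hξ'meas hindep habs hcross
  have hbound : ∀ z, f z ⬝ᵥ (x + z) - ∫ ω', f (ξ ω') ⬝ᵥ (x + ξ ω') ∂P ≤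
      |f z ⬝ᵥ z| + ∫ ω', |f z ⬝ᵥ ξ' ω'| ∂P := by
    intro z
    have hz : Integrable (fun ω => f z ⬝ᵥ ξ' ω) P :=
      hint (fun _ => f z) _ measurable_const (fun _ => hfD _) hξ'meas hξ'int
    have hlower : f z ⬝ᵥ x - ∫ ω, |f z ⬝ᵥ ξ' ω| ∂P ≤ ∫ ω, f (ξ' ω) ⬝ᵥ (x + ξ' ω) ∂P := by
      calc f z ⬝ᵥ x - ∫ ω, |f z ⬝ᵥ ξ' ω| ∂P
          = ∫ ω, (f z ⬝ᵥ x - |f z ⬝ᵥ ξ' ω|) ∂P := by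
            rw [integral_sub (integrable_const _) hz.abs]
            simp
        _ ≤ _ := integral_mono ((integrable_const _).sub hz.abs) hvalue_int' fun ω => by
            have hmax := hfmax (ξ' ω) (f z) (hfD z)
            rw [dotProduct_add] at hmax
            dsimp only
            linarith [neg_abs_le (f z ⬝ᵥ ξ' ω)]
    rw [hcopy, dotProduct_add]
    linarith [le_abs_self (f z ⬝ᵥ z)]
  calc _ ≤ ∫ ω, (|f (ξ ω) ⬝ᵥ ξ ω| + ∫ ω', |f (ξ ω) ⬝ᵥ ξ' ω'| ∂P) ∂P :=
        integral_mono (hvalue_int.sub (integrable_const _)).pos_part (hself.add hfub_int)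
          fun ω => max_le (hbound (ξ ω))
            (add_nonneg (abs_nonneg _) (integral_nonneg fun _ => abs_nonneg _))
    _ = _ := by rw [integral_add hself hfub_int, hfub]
end

section
/- Let m ≥ 1 and K ≥ 1 be integers, λ > 0, C > 0, H > 0, and let d̂_1, …, d̂_K ∈ ℝ^m satisfy ‖d̂_k‖₂ ≤ H for every k. Define B_k = λ·I_m + Σ_{s=1}^k d̂_s d̂_sᵀ, and define A_0 = λ·I_m and, recursively for k = 1, …, K, A_k = B_k if det(B_k) > (1 + C)·det(A_{k−1}), and A_k = A_{k−1} otherwise. Then the number of updates satisfies Σ_{k=1}^K 1{A_k ≠ A_{k−1}} ≤ (m / log(1 + C)) · log(1 + K·H²/(λ·m)). -/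
open Matrix Finset
open scoped Classical

/-- The determinant–trace inequality for positive semidefinite real matrices. -/
theorem Matrix.PosSemidef.det_le_trace_div_card_pow {n : Type*} [Fintype n] [DecidableEq n]
    [Nonempty n] {M : Matrix n n ℝ} (hM : M.PosSemidef) :
    M.det ≤ (M.trace / Fintype.card n) ^ Fintype.card n := by
  have hcard : (0 : ℝ) < Fintype.card n := by exact_mod_cast Fintype.card_pos
  have hprod : 0 ≤ ∏ i, hM.isHermitian.eigenvalues i :=
    Finset.prod_nonneg fun i _ => hM.eigenvalues_nonneg i
  have amgm := Real.geom_mean_le_arith_mean Finset.univ (fun _ => (1 : ℝ))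
    hM.isHermitian.eigenvalues (fun _ _ => zero_le_one) (by simpa using hcard)
    (fun i _ => hM.eigenvalues_nonneg i)
  simp only [Real.rpow_one, Finset.sum_const, Finset.card_univ, nsmul_eq_mul, mul_one,
    one_mul] at amgm
  have hpow := pow_le_pow_left₀ (Real.rpow_nonneg hprod _) amgm (Fintype.card n)
  rw [Real.rpow_inv_natCast_pow hprod Fintype.card_ne_zero] at hpow
  simpa [hM.isHermitian.det_eq_prod_eigenvalues, hM.isHermitian.trace_eq_sum_eigenvalues]
    using hpow

/-- A determinant bound for a regularized Gram matrix of bounded vectors. -/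
theorem det_smul_one_add_sum_vecMulVec_le {ι n : Type*} [Fintype n] [DecidableEq n] [Nonempty n]
    {lam H : ℝ} (hlam : 0 ≤ lam) (s : Finset ι) (v : ι → n → ℝ)
    (hv : ∀ i ∈ s, v i ⬝ᵥ v i ≤ H ^ 2) :
    (lam • (1 : Matrix n n ℝ) + ∑ i ∈ s, vecMulVec (v i) (v i)).det ≤
      (lam + #s * H ^ 2 / Fintype.card n) ^ Fintype.card n := by
  have hcard : (0 : ℝ) < Fintype.card n := by exact_mod_cast Fintype.card_pos
  have hpsd : (lam • (1 : Matrix n n ℝ) + ∑ i ∈ s, vecMulVec (v i) (v i)).PosSemidef :=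
    (PosSemidef.one.smul hlam).add <| posSemidef_sum s fun i _ => by
      simpa using posSemidef_vecMulVec_self_star (v i)
  refine hpsd.det_le_trace_div_card_pow.trans
    (pow_le_pow_left₀ (div_nonneg hpsd.trace_nonneg hcard.le) ?_ _)
  have hsum : ∑ i ∈ s, v i ⬝ᵥ v i ≤ #s * H ^ 2 := by
    simpa using Finset.sum_le_sum hv
  rw [div_le_iff₀ hcard, add_mul, div_mul_cancel₀ _ hcard.ne']
  simpa [trace_add, trace_smul, trace_sum, trace_vecMulVec] using hsum

/-- Switching bound for the Rarely-Switching update rule (Lemma 7): the lazily updated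
Gram matrix `A_k` changes at most `(m / log(1+C)) · log(1 + K·H²/(λ·m))` times. -/
theorem rarely_switching_bound
    (m K : ℕ) (hm : 1 ≤ m) (hK : 1 ≤ K)
    (lam C H : ℝ) (hlam : 0 < lam) (hC : 0 < C) (hH : 0 < H)
    (dhat : ℕ → Fin m → ℝ)
    (hd : ∀ k ∈ Finset.Icc 1 K, Real.sqrt (dhat k ⬝ᵥ dhat k) ≤ H)
    (B A : ℕ → Matrix (Fin m) (Fin m) ℝ)
    (hB : ∀ k, B k = lam • (1 : Matrix (Fin m) (Fin m) ℝ) +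
      ∑ s ∈ Finset.Icc 1 k, vecMulVec (dhat s) (dhat s))
    (hA0 : A 0 = lam • (1 : Matrix (Fin m) (Fin m) ℝ))
    (hAupd : ∀ k ∈ Finset.Icc 1 K,
      ((1 + C) * (A (k - 1)).det < (B k).det → A k = B k) ∧
      (¬ (1 + C) * (A (k - 1)).det < (B k).det → A k = A (k - 1))) :
    (((Finset.Icc 1 K).filter fun k => A k ≠ A (k - 1)).card : ℝ) ≤
      (m / Real.log (1 + C)) * Real.log (1 + K * H ^ 2 / (lam * m)) := by
  have hm0 : (0 : ℝ) < m := by exact_mod_cast hm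
  have : Nonempty (Fin m) := ⟨⟨0, hm⟩⟩
  have growth : ∀ n ≤ K,
      (1 + C) ^ #{k ∈ Finset.Icc 1 n | A k ≠ A (k - 1)} * lam ^ m ≤ (A n).det ∧
        ∃ j ≤ n, A n = B j := by
    intro n
    induction n with
    | zero => exact fun _ => ⟨by simp [hA0], 0, le_rfl, by simp [hA0, hB]⟩
    | succ n ih =>
      intro hn
      obtain ⟨ihdet, j, hj, hAj⟩ := ih (by omega)
      obtain ⟨hswitch, hstay⟩ := hAupd (n + 1) (Finset.mem_Icc.2 ⟨by omega, hn⟩)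
      rw [Nat.add_sub_cancel] at hswitch hstay
      rw [← Finset.insert_Icc_right_eq_Icc_add_one (by omega), Finset.filter_insert]
      simp only [Nat.add_sub_cancel]
      by_cases h : (1 + C) * (A n).det < (B (n + 1)).det
      · refine ⟨?_, n + 1, le_rfl, hswitch h⟩
        have hpos : 0 < (A n).det := lt_of_lt_of_le (by positivity) ihdet
        have hne : A (n + 1) ≠ A n := by
          intro he
          rw [← hswitch h, he] at h
          nlinarith [mul_pos hC hpos]
        rw [if_pos hne, Finset.card_insert_of_notMem (by simp), hswitch h, pow_succ', mul_assoc]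
        exact (mul_le_mul_of_nonneg_left ihdet (by positivity)).trans h.le
      · rw [if_neg (not_not.2 (hstay h)), hstay h]
        exact ⟨ihdet, j, by omega, hAj⟩
  obtain ⟨hdet, j, hj, hAj⟩ := growth K le_rfl
  have hupper : (A K).det ≤ (lam + K * H ^ 2 / m) ^ m := by
    have hbound := det_smul_one_add_sum_vecMulVec_le hlam.le (Finset.Icc 1 j) dhat (H := H)
      fun k hk => (Real.sqrt_le_left hH.le).1
        (hd k (Finset.Icc_subset_Icc_right hj hk))
    rw [hAj, hB]
    simp only [Nat.card_Icc, Nat.add_sub_cancel, Fintype.card_fin] at hbound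
    refine hbound.trans ?_
    have : (j : ℝ) ≤ K := by exact_mod_cast hj
    gcongr
  have hlog : 0 < Real.log (1 + C) := Real.log_pos (by linarith)
  have hfactor : lam + K * H ^ 2 / m = (1 + K * H ^ 2 / (lam * m)) * lam := by
    field_simp
  rw [hfactor, mul_pow] at hupper
  have hpow := le_of_mul_le_mul_right (hdet.trans hupper) (pow_pos hlam m)
  have hlogs := Real.log_le_log (by positivity) hpow
  rw [Real.log_pow, Real.log_pow] at hlogs
  rwa [div_mul_eq_mul_div, le_div_iff₀ hlog]
end

section
/- Let m ≥ 1 be an integer, C > 0, and let A, B ∈ ℝ^{m×m} be positive definite matrices such that B − A is positive semidefinite and det(B) ≤ (1 + C)·det(A). Then for every x ∈ ℝ^m, ‖x‖_{A⁻¹} ≤ √(1 + C) · ‖x‖_{B⁻¹}. -/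
open Matrix

/-- `‖x‖_M = √(xᵀ M x)` for a matrix `M` and vector `x`. -/
noncomputable def quadNorm {m : ℕ} (M : Matrix (Fin m) (Fin m) ℝ) (x : Fin m → ℝ) : ℝ :=
  Real.sqrt (x ⬝ᵥ (M *ᵥ x))

open scoped MatrixOrder Matrix.Norms.L2Operator in
/-- Simultaneous diagonalization by congruence of a positive definite and a symmetric matrix. -/
theorem Matrix.PosDef.exists_transpose_mul_mul_eq_one_and_diagonal {n : Type*} [Fintype n]
    [DecidableEq n] {A D : Matrix n n ℝ} (hA : A.PosDef) (hD : D.IsHermitian) :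
    ∃ (W : Matrix n n ℝ) (d : n → ℝ), Wᵀ * A * W = 1 ∧ Wᵀ * D * W = diagonal d := by
  obtain ⟨S, hS, hAS⟩ := CStarAlgebra.isStrictlyPositive_iff_eq_star_mul_self.mp
    hA.isStrictlyPositive
  rw [star_eq_conjTranspose, conjTranspose_eq_transpose_of_trivial] at hAS
  have hSdet : IsUnit S.det := (isUnit_iff_isUnit_det S).mp hS
  have hE : (S⁻¹ᵀ * D * S⁻¹).IsHermitian := by
    simpa using isHermitian_conjTranspose_mul_mul S⁻¹ hD
  set U : Matrix n n ℝ := hE.eigenvectorUnitary.val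
  have hUU : Uᵀ * U = 1 := by
    simpa [star_eq_conjTranspose] using Unitary.coe_star_mul_self hE.eigenvectorUnitary
  refine ⟨S⁻¹ * U, hE.eigenvalues, ?_, ?_⟩
  · calc (S⁻¹ * U)ᵀ * A * (S⁻¹ * U) = Uᵀ * ((S * S⁻¹)ᵀ * (S * S⁻¹)) * U := by
          rw [hAS]; simp only [transpose_mul, Matrix.mul_assoc]
      _ = 1 := by rw [mul_nonsing_inv _ hSdet]; simpa using hUU
  · have h := hE.conjStarAlgAut_star_eigenvectorUnitary
    rw [Unitary.conjStarAlgAut_star_apply] at h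
    calc (S⁻¹ * U)ᵀ * D * (S⁻¹ * U) = Uᵀ * (S⁻¹ᵀ * D * S⁻¹) * U := by
          simp only [transpose_mul, Matrix.mul_assoc]
      _ = diagonal hE.eigenvalues := by
          simpa [star_eq_conjTranspose, Function.comp_def] using h

theorem Matrix.inv_eq_mul_inv_mul_transpose {n R : Type*} [Fintype n] [DecidableEq n] [CommRing R]
    {M N W : Matrix n n R} (hW : IsUnit W.det) (h : Wᵀ * M * W = N) :
    M⁻¹ = W * N⁻¹ * Wᵀ := by
  have hWt : IsUnit Wᵀ.det := by rwa [det_transpose]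
  rw [← h, mul_inv_rev, mul_inv_rev, ← Matrix.mul_assoc, ← Matrix.mul_assoc,
    mul_nonsing_inv _ hW, Matrix.one_mul, nonsing_inv_mul_cancel_right _ _ hWt]

theorem dotProduct_mul_diagonal_mul_transpose_mulVec {n R : Type*} [Fintype n] [DecidableEq n]
    [CommRing R] (W : Matrix n n R) (d : n → R) (x : n → R) :
    x ⬝ᵥ ((W * diagonal d * Wᵀ) *ᵥ x) = ∑ i, d i * (Wᵀ *ᵥ x) i ^ 2 := by
  rw [← mulVec_mulVec, ← mulVec_mulVec, dotProduct_mulVec, ← mulVec_transpose, dotProduct]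
  exact Finset.sum_congr rfl fun i _ => by rw [mulVec_diagonal]; ring

/-- If `A ⪯ B` (both positive definite) and `det B ≤ (1+C)·det A`, then
`‖x‖_{A⁻¹} ≤ √(1+C)·‖x‖_{B⁻¹}` for every `x`. -/
theorem quadNorm_inv_le_sqrt_one_add_mul
    (m : ℕ) (hm : 1 ≤ m) (C : ℝ) (hC : 0 < C)
    (A B : Matrix (Fin m) (Fin m) ℝ)
    (hA : A.PosDef) (hB : B.PosDef)
    (hBA : (B - A).PosSemidef)
    (hdet : B.det ≤ (1 + C) * A.det)
    (x : Fin m → ℝ) :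
    quadNorm A⁻¹ x ≤ Real.sqrt (1 + C) * quadNorm B⁻¹ x := by
  obtain ⟨W, d, hWA, hWD⟩ := hA.exists_transpose_mul_mul_eq_one_and_diagonal hBA.1
  have hd : ∀ i, 0 ≤ d i := by
    have h := hBA.conjTranspose_mul_mul_same W
    rw [conjTranspose_eq_transpose_of_trivial, hWD, posSemidef_diagonal_iff] at h
    exact h
  have hWB : Wᵀ * B * W = diagonal fun i => 1 + d i := by
    rw [← diagonal_add, diagonal_one, ← hWA, ← hWD]
    noncomm_ring
  have hdetA : W.det ^ 2 * A.det = 1 := by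
    have h := congrArg det hWA
    rw [det_mul, det_mul, det_transpose, det_one] at h
    linarith
  have hdetB : W.det ^ 2 * B.det = ∏ i, (1 + d i) := by
    have h := congrArg det hWB
    rw [det_mul, det_mul, det_transpose, det_diagonal] at h
    linarith
  have hW : IsUnit W.det := by
    refine isUnit_iff_ne_zero.mpr fun h => ?_
    simp [h] at hdetA
  have hle : ∀ i, 1 + d i ≤ 1 + C := fun i => calc
    1 + d i = ∏ j ∈ {i}, (1 + d j) := (Finset.prod_singleton _ _).symm
    _ ≤ ∏ j, (1 + d j) :=
      Finset.prod_le_prod_of_subset_of_one_le (Finset.subset_univ _)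
        (fun j _ => by linarith [hd j]) (fun j _ _ => by linarith [hd j])
    _ = W.det ^ 2 * B.det := hdetB.symm
    _ ≤ W.det ^ 2 * ((1 + C) * A.det) := by gcongr
    _ = 1 + C := by linear_combination (1 + C) * hdetA
  have hinvB : (diagonal fun i => 1 + d i)⁻¹ = diagonal fun i => (1 + d i)⁻¹ := by
    refine inv_eq_right_inv ?_
    rw [diagonal_mul_diagonal, ← diagonal_one]
    congr 1
    ext i
    exact mul_inv_cancel₀ (by linarith [hd i])
  rw [quadNorm, quadNorm, ← Real.sqrt_mul (by linarith)]
  refine Real.sqrt_le_sqrt ?_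
  rw [inv_eq_mul_inv_mul_transpose hW hWA, inv_eq_mul_inv_mul_transpose hW hWB, hinvB, inv_one,
    ← diagonal_one, dotProduct_mul_diagonal_mul_transpose_mulVec,
    dotProduct_mul_diagonal_mul_transpose_mulVec, Finset.mul_sum]
  refine Finset.sum_le_sum fun i _ => ?_
  rw [← mul_assoc]
  gcongr
  rw [← div_eq_mul_inv, one_le_div (by linarith [hd i])]
  exact hle i
end

section
/- Let H ≥ 1 and K ≥ 1 be integers and let n : ℕ → ℕ be a nondecreasing sequence such that n_k − n_{k−1} ≤ H for every 1 ≤ k ≤ K. Then Σ_{k=1}^K 1{n_{k−1} ≥ H} · (n_k − n_{k−1}) / max(n_{k−1}, 1) ≤ 2·log(max(n_K, 1)). -/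
open Finset

/-- If `0 < b ≤ a ≤ 2 * b`, the relative increment from `b` to `a` is at most twice the
logarithmic increment. -/
theorem sub_div_le_two_mul_log_sub_log {a b : ℝ} (hb : 0 < b) (hba : b ≤ a) (hab : a ≤ 2 * b) :
    (a - b) / b ≤ 2 * (Real.log a - Real.log b) := by
  have ha : 0 < a := hb.trans_le hba
  calc (a - b) / b ≤ 2 * (1 - (a / b)⁻¹) := by
        rw [inv_div, one_sub_div ha.ne', mul_div_assoc', div_le_div_iff₀ hb ha]
        nlinarith
    _ ≤ 2 * Real.log (a / b) := by
        gcongr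
        exact Real.one_sub_inv_le_log_of_pos (div_pos ha hb)
    _ = 2 * (Real.log a - Real.log b) := by rw [Real.log_div ha.ne' hb.ne']

/-- Cumulative visitation bound (Lemma F.2): for a nondecreasing counter `n` with
per-step increments at most `H`,
`Σ_{k=1}^K 1{n_{k-1} ≥ H} (n_k - n_{k-1}) / max(n_{k-1},1) ≤ 2 log (max(n_K,1))`. -/
theorem cumulative_visitation_bound
    (H K : ℕ) (hH : 1 ≤ H) (hK : 1 ≤ K)
    (n : ℕ → ℕ) (hmono : Monotone n)
    (hinc : ∀ k, 1 ≤ k → k ≤ K → n k - n (k - 1) ≤ H) :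
    ∑ k ∈ Finset.Icc 1 K,
        (if H ≤ n (k - 1) then ((n k : ℝ) - (n (k - 1) : ℝ)) / ((max (n (k - 1)) 1 : ℕ) : ℝ)
          else 0)
      ≤ 2 * Real.log ((max (n K) 1 : ℕ) : ℝ) := by
  clear hK
  induction K with
  | zero =>
    have : 0 ≤ Real.log ((max (n 0) 1 : ℕ) : ℝ) := Real.log_natCast_nonneg _
    simpa using this
  | succ K ih =>
    rw [Finset.sum_Icc_succ_top (by omega), Nat.add_sub_cancel]
    have ih := ih fun k h1 hk => hinc k h1 (hk.trans K.le_succ)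
    have hle : n K ≤ n (K + 1) := hmono K.le_succ
    split_ifs with hn
    · have hstep : n (K + 1) ≤ 2 * n K := by
        have := hinc (K + 1) (by omega) le_rfl
        rw [Nat.add_sub_cancel] at this
        omega
      rw [max_eq_left (by omega : 1 ≤ n K)] at ih ⊢
      rw [max_eq_left (by omega : 1 ≤ n (K + 1))]
      have := sub_div_le_two_mul_log_sub_log (a := n (K + 1)) (b := n K)
        (by exact_mod_cast (by omega : 0 < n K)) (by exact_mod_cast hle)
        (by exact_mod_cast hstep)
      linarith
    · rw [add_zero]
      refine ih.trans ?_
      gcongr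
end

section
/- Let m ≥ 1, H ≥ 1 and K ≥ 1 be integers, δ ∈ (0,1), let I be a finite set with |I| = m, and let (F_k)_{k≥0} be a filtration on a probability space. For each 1 ≤ k ≤ K, let Z_k : Ω → (I → ℕ) be F_k-measurable with Σ_{i∈I} Z_k(i) = H almost surely, and define the counts n_k(i) = Σ_{l=1}^k Z_l(i) (so n_0(i) = 0). Then with probability at least 1 − δ, Σ_{k=1}^K E[ Σ_{i∈I} Z_k(i) / √(max(n_{k−1}(i), 1)) | F_{k−1} ] ≤ 16·H²·log(1/δ) + 4·m·H + 2√2·√(m·H·K·log(H·K)). -/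
open MeasureTheory Finset

/-- The chord-type bound `exp (-t) ≤ 1 - (7/8) t` on `[0, 1/4]`. -/
lemma exp_neg_le_one_sub_of_le_quarter {t : ℝ} (h0 : 0 ≤ t) (h1 : t ≤ 1 / 4) :
    Real.exp (-t) ≤ 1 - 7 / 8 * t := by
  have hq := Real.quadratic_le_exp_of_nonneg h0
  have hprod : 1 ≤ (1 - 7 / 8 * t) * Real.exp t := by
    have hpoly : 1 ≤ (1 - 7 / 8 * t) * (1 + t + t ^ 2 / 2) := by
      nlinarith [mul_nonneg h0 (sub_nonneg.2 h1), mul_nonneg (mul_nonneg h0 h0) (sub_nonneg.2 h1)]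
    exact hpoly.trans (mul_le_mul_of_nonneg_left hq (by linarith))
  rw [Real.exp_neg, inv_le_iff_one_le_mul₀ (Real.exp_pos t)]
  exact hprod

section Concentration

variable {Ω : Type*} {m0 : MeasurableSpace Ω} {P : Measure Ω}

lemma integral_mul_condExp_of_stronglyMeasurable {F : MeasurableSpace Ω} (hF : F ≤ m0)
    [SigmaFinite (P.trim hF)] {g X : Ω → ℝ} (hg : StronglyMeasurable[F] g)
    (hgX : Integrable (g * X) P) (hX : Integrable X P) :
    ∫ ω, g ω * (P[X | F]) ω ∂P = ∫ ω, g ω * X ω ∂P := by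
  have h := condExp_mul_of_stronglyMeasurable_left hg hgX hX
  calc ∫ ω, g ω * (P[X | F]) ω ∂P = ∫ ω, (P[g * X | F]) ω ∂P :=
        integral_congr_ae (h.mono fun ω hω => hω.symm)
    _ = ∫ ω, g ω * X ω ∂P := integral_condExp hF

lemma integrable_exp_of_ae_le [IsFiniteMeasure P] {S : Ω → ℝ} {C : ℝ}
    (hS : AEStronglyMeasurable S P) (hC : ∀ᵐ ω ∂P, S ω ≤ C) :
    Integrable (fun ω => Real.exp (S ω)) P := by
  refine Integrable.of_bound (Real.continuous_exp.comp_aestronglyMeasurable hS) (Real.exp C) ?_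
  filter_upwards [hC] with ω hω
  rw [Real.norm_eq_abs, Real.abs_exp]
  exact Real.exp_le_exp.2 hω

lemma condExp_mem_Icc [IsFiniteMeasure P] {F : MeasurableSpace Ω} (hF : F ≤ m0) {X : Ω → ℝ}
    {B : ℝ} (hX : Integrable X P) (hXB : ∀ᵐ ω ∂P, X ω ∈ Set.Icc 0 B) :
    ∀ᵐ ω ∂P, (P[X | F]) ω ∈ Set.Icc 0 B := by
  have h0 : 0 ≤ᵐ[P] P[X | F] := condExp_nonneg (hXB.mono fun ω hω => hω.1)
  have h1 : P[X | F] ≤ᵐ[P] P[fun _ => B | F] :=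
    condExp_mono hX (integrable_const B) (hXB.mono fun ω hω => hω.2)
  rw [condExp_const hF] at h1
  filter_upwards [h0, h1] with ω a b using ⟨a, b⟩

/-- The exponential process comparing the compensator of a bounded nonnegative adapted process
with the process itself has expectation at most one. -/
lemma integral_exp_sum_condExp_sub_le_one [IsProbabilityMeasure P] (𝓕 : Filtration ℕ m0)
    {B : ℝ} (hB : 0 < B) (X : ℕ → Ω → ℝ) (N : ℕ)
    (hmeas : ∀ k < N, StronglyMeasurable[𝓕 (k + 1)] (X k))
    (hbdd : ∀ k < N, ∀ᵐ ω ∂P, X k ω ∈ Set.Icc 0 B) :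
    Integrable (fun ω => Real.exp
      (∑ k ∈ range N, (7 / 8 * (P[X k | 𝓕 k]) ω - X k ω) / (4 * B))) P ∧
    ∫ ω, Real.exp (∑ k ∈ range N, (7 / 8 * (P[X k | 𝓕 k]) ω - X k ω) / (4 * B)) ∂P ≤ 1 := by
  have hint : ∀ k < N, Integrable (X k) P := fun k hk =>
    Integrable.of_bound ((hmeas k hk).mono (𝓕.le _)).aestronglyMeasurable B <| by
      filter_upwards [hbdd k hk] with ω hω
      rw [Real.norm_eq_abs, abs_of_nonneg hω.1]
      exact hω.2
  have hY : ∀ k < N, ∀ᵐ ω ∂P, (P[X k | 𝓕 k]) ω ∈ Set.Icc 0 B := fun k hk =>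
    condExp_mem_Icc (𝓕.le k) (hint k hk) (hbdd k hk)
  set S : ℕ → Ω → ℝ := fun j ω => ∑ k ∈ range j, (7 / 8 * (P[X k | 𝓕 k]) ω - X k ω) / (4 * B)
    with hSdef
  have hS_meas : ∀ j ≤ N, StronglyMeasurable[𝓕 j] (S j) := by
    intro j hj
    refine Finset.stronglyMeasurable_fun_sum _ fun k hk => ?_
    have hkj : k < j := Finset.mem_range.1 hk
    have hcond : StronglyMeasurable[𝓕 j] (P[X k | 𝓕 k]) :=
      stronglyMeasurable_condExp.mono (𝓕.mono hkj.le)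
    have hXk : StronglyMeasurable[𝓕 j] (X k) := (hmeas k (by omega)).mono (𝓕.mono hkj)
    simp_rw [div_eq_mul_inv]
    exact ((hcond.const_mul _).sub hXk).mul_const _
  have hS_le : ∀ j ≤ N, ∀ᵐ ω ∂P, S j ω ≤ j := by
    intro j hj
    have hall : ∀ᵐ ω ∂P, ∀ k ∈ range j, X k ω ∈ Set.Icc 0 B ∧ (P[X k | 𝓕 k]) ω ∈ Set.Icc 0 B := by
      refine (Finset.eventually_all _).2 fun k hk => ?_
      have hkN : k < N := (Finset.mem_range.1 hk).trans_le hj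
      filter_upwards [hbdd k hkN, hY k hkN] with ω a b using ⟨a, b⟩
    filter_upwards [hall] with ω hω
    calc S j ω ≤ ∑ k ∈ range j, (1 : ℝ) := by
          refine Finset.sum_le_sum fun k hk => ?_
          obtain ⟨⟨h1, _⟩, _, h2⟩ := hω k hk
          rw [div_le_one (by positivity)]
          linarith
      _ = j := by simp
  have hS_int : ∀ j ≤ N, Integrable (fun ω => Real.exp (S j ω)) P := fun j hj =>
    integrable_exp_of_ae_le ((hS_meas j hj).mono (𝓕.le j)).aestronglyMeasurable (hS_le j hj)
  refine ⟨hS_int N le_rfl, ?_⟩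
  suffices h : ∀ j ≤ N, ∫ ω, Real.exp (S j ω) ∂P ≤ 1 from h N le_rfl
  intro j
  induction j with
  | zero => intro _; simp [hSdef]
  | succ j ih =>
    intro hj
    have hjN : j < N := hj
    set Y : Ω → ℝ := P[X j | 𝓕 j] with hYdef
    set c : ℝ := 7 / 8 / (4 * B) with hc
    have hc0 : 0 < c := by positivity
    set g : Ω → ℝ := fun ω => Real.exp (S j ω + c * Y ω) with hg
    have hexp_meas : StronglyMeasurable[𝓕 j] (fun ω => S j ω + c * Y ω) :=
      (hS_meas j hjN.le).add (stronglyMeasurable_condExp.const_mul c)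
    have hg_meas : StronglyMeasurable[𝓕 j] g :=
      Real.continuous_exp.comp_stronglyMeasurable hexp_meas
    have hg_int : Integrable g P := by
      refine integrable_exp_of_ae_le (C := j + c * B)
        (hexp_meas.mono (𝓕.le j)).aestronglyMeasurable ?_
      filter_upwards [hS_le j hjN.le, hY j hjN] with ω h1 h2
      exact add_le_add h1 (mul_le_mul_of_nonneg_left h2.2 hc0.le)
    have hnorm : ∀ {x : ℝ}, x ∈ Set.Icc 0 B → ‖x‖ ≤ B := fun h => by
      rw [Real.norm_eq_abs, abs_of_nonneg h.1]; exact h.2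
    have hgX : Integrable (fun ω => g ω * X j ω) P :=
      hg_int.mul_bdd (hint j hjN).aestronglyMeasurable ((hbdd j hjN).mono fun ω => hnorm)
    have hgY : Integrable (fun ω => g ω * Y ω) P :=
      hg_int.mul_bdd integrable_condExp.aestronglyMeasurable ((hY j hjN).mono fun ω => hnorm)
    have hpull : ∫ ω, g ω * Y ω ∂P = ∫ ω, g ω * X j ω ∂P :=
      integral_mul_condExp_of_stronglyMeasurable (𝓕.le j) hg_meas hgX (hint j hjN)
    calc ∫ ω, Real.exp (S (j + 1) ω) ∂P
        ≤ ∫ ω, (g ω - c * (g ω * X j ω)) ∂P := by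
          refine integral_mono_ae (hS_int _ hj) (hg_int.sub (hgX.const_mul c)) ?_
          filter_upwards [hbdd j hjN] with ω hω
          have hle : X j ω / (4 * B) ≤ 1 / 4 := by
            rw [div_le_iff₀ (by positivity)]
            linarith [hω.2]
          have hchord := exp_neg_le_one_sub_of_le_quarter
            (div_nonneg hω.1 (by positivity : (0 : ℝ) ≤ 4 * B)) hle
          have hsplit : S (j + 1) ω = (S j ω + c * Y ω) + -(X j ω / (4 * B)) := by
            simp only [hSdef, Finset.sum_range_succ, hc, hYdef]
            ring
          change Real.exp (S (j + 1) ω) ≤ g ω - c * (g ω * X j ω)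
          rw [hsplit, Real.exp_add]
          calc _ ≤ g ω * (1 - 7 / 8 * (X j ω / (4 * B))) :=
                mul_le_mul_of_nonneg_left hchord (Real.exp_pos _).le
            _ = g ω - c * (g ω * X j ω) := by rw [hc]; ring
      _ = ∫ ω, (g ω - c * (g ω * Y ω)) ∂P := by
          rw [integral_sub hg_int (hgX.const_mul c), integral_sub hg_int (hgY.const_mul c),
            integral_const_mul, integral_const_mul, hpull]
      _ ≤ ∫ ω, Real.exp (S j ω) ∂P := by
          refine integral_mono (hg_int.sub (hgY.const_mul c)) (hS_int _ hjN.le) fun ω => ?_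
          have h1 : 1 - c * Y ω ≤ Real.exp (-(c * Y ω)) := Real.one_sub_le_exp_neg _
          calc g ω - c * (g ω * Y ω) = g ω * (1 - c * Y ω) := by ring
            _ ≤ g ω * Real.exp (-(c * Y ω)) := mul_le_mul_of_nonneg_left h1 (Real.exp_pos _).le
            _ = Real.exp (S j ω) := by rw [hg, ← Real.exp_add]; congr 1; ring
      _ ≤ 1 := ih hjN.le

/-- A multiplicative Freedman-type inequality: with high probability the compensator of a bounded
nonnegative adapted process is controlled by the process itself. -/
lemma measure_sum_condExp_le_sum_add [IsProbabilityMeasure P] (𝓕 : Filtration ℕ m0)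
    {B : ℝ} (hB : 0 < B) (X : ℕ → Ω → ℝ) (N : ℕ)
    (hmeas : ∀ k < N, StronglyMeasurable[𝓕 (k + 1)] (X k))
    (hbdd : ∀ k < N, ∀ᵐ ω ∂P, X k ω ∈ Set.Icc 0 B) {δ : ℝ} (hδ : 0 < δ) :
    ENNReal.ofReal (1 - δ) ≤ P {ω | 7 / 8 * ∑ k ∈ range N, (P[X k | 𝓕 k]) ω ≤
      ∑ k ∈ range N, X k ω + 4 * B * Real.log (1 / δ)} := by
  obtain ⟨hint, hle⟩ := integral_exp_sum_condExp_sub_le_one 𝓕 hB X N hmeas hbdd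
  set M : Ω → ℝ := fun ω => Real.exp
    (∑ k ∈ range N, (7 / 8 * (P[X k | 𝓕 k]) ω - X k ω) / (4 * B)) with hM
  have hmarkov := mul_meas_ge_le_integral_of_nonneg
    (Filter.Eventually.of_forall fun ω => (Real.exp_pos _).le : 0 ≤ᵐ[P] M) hint (1 / δ)
  have hbad : P {ω | 1 / δ ≤ M ω} ≤ ENNReal.ofReal δ := by
    rw [← ofReal_measureReal]
    refine ENNReal.ofReal_le_ofReal ?_
    rw [← mul_one δ, ← inv_mul_le_iff₀ hδ, ← one_div]
    simpa using hmarkov.trans hle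
  have hsub : {ω | 1 / δ ≤ M ω}ᶜ ⊆ {ω | 7 / 8 * ∑ k ∈ range N, (P[X k | 𝓕 k]) ω ≤
      ∑ k ∈ range N, X k ω + 4 * B * Real.log (1 / δ)} := by
    intro ω hω
    have hlt : M ω < 1 / δ := not_le.1 hω
    have hlog := (Real.lt_log_iff_exp_lt (by positivity)).2 hlt
    rw [← Finset.sum_div, div_lt_iff₀ (by positivity), Finset.sum_sub_distrib,
      ← Finset.mul_sum] at hlog
    change 7 / 8 * ∑ k ∈ range N, (P[X k | 𝓕 k]) ω ≤
      ∑ k ∈ range N, X k ω + 4 * B * Real.log (1 / δ)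
    linarith
  refine le_trans ?_ (measure_mono hsub)
  have hone : (1 : ENNReal) ≤ P {ω | 1 / δ ≤ M ω} + P {ω | 1 / δ ≤ M ω}ᶜ := by
    rw [← measure_univ (μ := P), ← Set.union_compl_self {ω | 1 / δ ≤ M ω}]
    exact measure_union_le _ _
  rw [ENNReal.ofReal_sub _ hδ.le, ENNReal.ofReal_one, tsub_le_iff_left]
  exact hone.trans (add_le_add_left hbad _)

end Concentration

/-- Deterministic bound on self-normalized cumulative increments bounded by `H`. -/
lemma sum_div_sqrt_cumulative_le (z : ℕ → ℕ) (H N : ℕ) (hz : ∀ k < N, z k ≤ H) :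
    ∑ k ∈ range N, (z k : ℝ) / Real.sqrt ((max (∑ l ∈ range k, z l) 1 : ℕ) : ℝ) ≤
      ((min (∑ l ∈ range N, z l) (2 * H) : ℕ) : ℝ) +
        2 * Real.sqrt 2 * Real.sqrt ((∑ l ∈ range N, z l : ℕ) : ℝ) := by
  induction N with
  | zero => simp
  | succ N ih =>
    have ih := ih fun k hk => hz k (by omega)
    have hzN := hz N (by omega)
    rw [Finset.sum_range_succ, Finset.sum_range_succ (fun l => z l)]
    set s := ∑ l ∈ range N, z l
    rcases lt_or_ge s H with hs | hs
    · have h1 : (z N : ℝ) / Real.sqrt ((max s 1 : ℕ) : ℝ) ≤ z N := by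
        refine div_le_self (by positivity) ?_
        rw [Real.one_le_sqrt]
        exact_mod_cast le_max_right s 1
      have h2 : min (s + z N) (2 * H) = min s (2 * H) + z N := by omega
      have h3 : Real.sqrt (s : ℝ) ≤ Real.sqrt ((s + z N : ℕ) : ℝ) :=
        Real.sqrt_le_sqrt (by push_cast; linarith [(z N).cast_nonneg (α := ℝ)])
      have h4 := mul_le_mul_of_nonneg_left h3 (by positivity : 0 ≤ 2 * Real.sqrt 2)
      rw [h2]
      push_cast at *
      linarith
    · have h1 : ((min s (2 * H) : ℕ) : ℝ) ≤ ((min (s + z N) (2 * H) : ℕ) : ℝ) := by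
        exact_mod_cast (by omega : min s (2 * H) ≤ min (s + z N) (2 * H))
      suffices h2 : (z N : ℝ) / Real.sqrt ((max s 1 : ℕ) : ℝ) ≤
          2 * Real.sqrt 2 * (Real.sqrt ((s + z N : ℕ) : ℝ) - Real.sqrt (s : ℝ)) by linarith
      rcases Nat.eq_zero_or_pos s with h0 | hpos
      · have hz0 : z N = 0 := by omega
        simp [hz0]
      · rw [max_eq_left hpos]
        have hsR : (0 : ℝ) < s := by exact_mod_cast hpos
        have ha : 0 < Real.sqrt (s : ℝ) := Real.sqrt_pos.2 hsR
        have ha2 := Real.sq_sqrt hsR.le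
        have hb2 : Real.sqrt ((s + z N : ℕ) : ℝ) ^ 2 = s + z N := by
          rw [Real.sq_sqrt (by positivity)]; push_cast; ring
        have hba : Real.sqrt (s : ℝ) ≤ Real.sqrt ((s + z N : ℕ) : ℝ) :=
          Real.sqrt_le_sqrt (by push_cast; linarith [(z N).cast_nonneg (α := ℝ)])
        have hb : Real.sqrt ((s + z N : ℕ) : ℝ) ≤ Real.sqrt 2 * Real.sqrt (s : ℝ) := by
          rw [← Real.sqrt_mul (by norm_num)]
          refine Real.sqrt_le_sqrt ?_
          exact_mod_cast (by omega : s + z N ≤ 2 * s)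
        have h2 : 1 ≤ Real.sqrt 2 := by rw [Real.one_le_sqrt]; norm_num
        rw [div_le_iff₀ ha]
        set a := Real.sqrt (s : ℝ)
        set b := Real.sqrt ((s + z N : ℕ) : ℝ)
        have hab : b + a ≤ 2 * Real.sqrt 2 * a := by nlinarith
        calc (z N : ℝ) = (b - a) * (b + a) := by linear_combination hb2.symm - ha2.symm
          _ ≤ (b - a) * (2 * Real.sqrt 2 * a) := mul_le_mul_of_nonneg_left hab (by linarith)
          _ = _ := by ring

/-- Deterministic cumulative visitation bound. -/
lemma sum_sum_div_sqrt_cumulative_le {I : Type*} [Fintype I] (z : ℕ → I → ℕ) (H N : ℕ)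
    (hz : ∀ k < N, ∑ i, z k i = H) :
    ∑ k ∈ range N, ∑ i, (z k i : ℝ) / Real.sqrt ((max (∑ l ∈ range k, z l i) 1 : ℕ) : ℝ) ≤
      2 * Fintype.card I * H + 2 * Real.sqrt 2 * Real.sqrt (Fintype.card I * H * N) := by
  have hle : ∀ i, ∀ k < N, z k i ≤ H := fun i k hk =>
    (hz k hk) ▸ Finset.single_le_sum (f := z k) (fun _ _ => Nat.zero_le _) (Finset.mem_univ i)
  have htot : ∑ i, ((∑ l ∈ range N, z l i : ℕ) : ℝ) = H * N := by
    rw [← Nat.cast_sum, Finset.sum_comm,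
      Finset.sum_congr rfl fun k hk => hz k (Finset.mem_range.1 hk)]
    simp [mul_comm]
  have hcs : ∑ i, Real.sqrt ((∑ l ∈ range N, z l i : ℕ) : ℝ) ≤
      Real.sqrt (Fintype.card I * H * N) := by
    refine Real.le_sqrt_of_sq_le ?_
    refine (sq_sum_le_card_mul_sum_sq).trans (le_of_eq ?_)
    simp_rw [Real.sq_sqrt (Nat.cast_nonneg _)]
    rw [htot, Finset.card_univ, mul_assoc]
  rw [Finset.sum_comm]
  calc _ ≤ ∑ i : I, ((2 * H : ℝ) +
        2 * Real.sqrt 2 * Real.sqrt ((∑ l ∈ range N, z l i : ℕ) : ℝ)) := by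
        refine Finset.sum_le_sum fun i _ => ?_
        refine (sum_div_sqrt_cumulative_le (fun k => z k i) H N (hle i)).trans ?_
        gcongr
        exact_mod_cast min_le_right _ _
    _ = 2 * Fintype.card I * H +
        2 * Real.sqrt 2 * ∑ i, Real.sqrt ((∑ l ∈ range N, z l i : ℕ) : ℝ) := by
        rw [Finset.sum_add_distrib, Finset.mul_sum, Finset.sum_const, Finset.card_univ,
          nsmul_eq_mul]
        ring
    _ ≤ _ := by gcongr

/-- Expected Cumulative Visitation Bound (Lemma F.1), abstract form: with probability
at least `1 - δ`,
`Σ_{k=1}^K E[Σ_i Z_k(i)/√(max(n_{k-1}(i),1)) | F_{k-1}]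
  ≤ 16H² log(1/δ) + 4mH + 2√2·√(mHK log(HK))`. -/
theorem expected_cumulative_visitation_bound
    {Ω : Type*} {m0 : MeasurableSpace Ω} (P : Measure Ω) [IsProbabilityMeasure P]
    (𝓕 : Filtration ℕ m0)
    (m H K : ℕ) (hm : 1 ≤ m) (hH : 1 ≤ H) (hK : 1 ≤ K)
    (δ : ℝ) (hδ : δ ∈ Set.Ioo (0 : ℝ) 1)
    (I : Type*) [Fintype I] (hcard : Fintype.card I = m)
    (Z : ℕ → Ω → I → ℕ)
    (hZadapt : ∀ k, 1 ≤ k → k ≤ K → Measurable[𝓕 k] (Z k))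
    (hZsum : ∀ k, 1 ≤ k → k ≤ K → ∀ᵐ ω ∂P, ∑ i : I, Z k ω i = H)
    (n : ℕ → Ω → I → ℕ)
    (hn : ∀ k ω i, n k ω i = ∑ l ∈ Finset.Icc 1 k, Z l ω i) :
    ENNReal.ofReal (1 - δ) ≤
      P {ω |
        ∑ k ∈ Finset.Icc 1 K,
          (P[fun ω' => ∑ i : I,
              (Z k ω' i : ℝ) / Real.sqrt ((max (n (k - 1) ω' i) 1 : ℕ) : ℝ) | 𝓕 (k - 1)]) ω
          ≤ 16 * H ^ 2 * Real.log (1 / δ) + 4 * m * H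
            + 2 * Real.sqrt 2 * Real.sqrt (m * H * K * Real.log (H * K))} := by
  subst hcard
  have hHR : (1 : ℝ) ≤ H := by exact_mod_cast hH
  have hHpos : (0 : ℝ) < H := by linarith
  have hmR : (1 : ℝ) ≤ Fintype.card I := by exact_mod_cast hm
  have hlogδ : 0 ≤ Real.log (1 / δ) :=
    Real.log_nonneg (by rw [le_div_iff₀ hδ.1]; linarith [hδ.2])
  have hcount : ∀ k ω i, n k ω i = ∑ l ∈ range k, Z (l + 1) ω i := fun k ω i => by
    rw [hn, Finset.range_eq_Ico, Finset.sum_Ico_add' (fun l => Z l ω i) 0 k 1]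
    rfl
  set X : ℕ → Ω → ℝ := fun k ω => ∑ i : I,
    (Z (k + 1) ω i : ℝ) / Real.sqrt ((max (n k ω i) 1 : ℕ) : ℝ) with hX
  have hreindex : ∀ ω, ∑ k ∈ Finset.Icc 1 K, (P[fun ω' => ∑ i : I,
      (Z k ω' i : ℝ) / Real.sqrt ((max (n (k - 1) ω' i) 1 : ℕ) : ℝ) | 𝓕 (k - 1)]) ω =
      ∑ k ∈ range K, (P[X k | 𝓕 k]) ω := fun ω => by
    rw [Finset.range_eq_Ico]
    exact (Finset.sum_Ico_add' (fun k => (P[fun ω' => ∑ i : I,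
      (Z k ω' i : ℝ) / Real.sqrt ((max (n (k - 1) ω' i) 1 : ℕ) : ℝ) | 𝓕 (k - 1)]) ω) 0 K 1).symm
  simp_rw [hreindex]
  have hZi : ∀ k < K, ∀ j, k < j → ∀ i, Measurable[𝓕 j] fun ω => Z (k + 1) ω i :=
    fun k hk j hkj i => (measurable_pi_apply i).comp
      ((hZadapt (k + 1) (by omega) (by omega)).mono (𝓕.mono hkj) le_rfl)
  have hmeas : ∀ k < K, StronglyMeasurable[𝓕 (k + 1)] (X k) := by
    intro k hk
    refine Measurable.stronglyMeasurable ?_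
    refine Finset.measurable_fun_sum _ fun i _ => ?_
    have hnk : Measurable[𝓕 (k + 1)] fun ω => n k ω i := by
      simp_rw [hcount]
      refine Finset.measurable_fun_sum _ fun l hl => ?_
      have hlk := Finset.mem_range.1 hl
      exact hZi l (by omega) (k + 1) (by omega) i
    exact (measurable_from_nat.comp (hZi k hk (k + 1) (by omega) i)).div
      ((measurable_from_nat (f := fun x : ℕ => Real.sqrt ((max x 1 : ℕ) : ℝ))).comp hnk)
  have hbdd : ∀ k < K, ∀ᵐ ω ∂P, X k ω ∈ Set.Icc (0 : ℝ) H := by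
    intro k hk
    filter_upwards [hZsum (k + 1) (by omega) (by omega)] with ω hω
    refine ⟨by positivity, ?_⟩
    calc X k ω ≤ ∑ i, (Z (k + 1) ω i : ℝ) := by
          refine Finset.sum_le_sum fun i _ => div_le_self (by positivity) ?_
          rw [Real.one_le_sqrt]
          exact_mod_cast le_max_right _ 1
      _ = H := by exact_mod_cast hω
  have hrest : 0 ≤ 2 * Real.sqrt 2 *
      Real.sqrt (Fintype.card I * H * K * Real.log (H * K)) := by positivity
  rcases le_or_gt K 4 with hK4 | hK4
  · have hint : ∀ k < K, Integrable (X k) P := fun k hk =>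
      Integrable.of_bound ((hmeas k hk).mono (𝓕.le _)).aestronglyMeasurable H <| by
        filter_upwards [hbdd k hk] with ω hω
        rw [Real.norm_eq_abs, abs_of_nonneg hω.1]
        exact hω.2
    have hall : ∀ᵐ ω ∂P, ∀ k ∈ range K, (P[X k | 𝓕 k]) ω ∈ Set.Icc (0 : ℝ) H :=
      (Finset.eventually_all _).2 fun k hk => condExp_mem_Icc (𝓕.le k)
        (hint k (Finset.mem_range.1 hk)) (hbdd k (Finset.mem_range.1 hk))
    refine le_trans (b := P Set.univ) (by simp [hδ.1.le]) (measure_mono_ae ?_)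
    filter_upwards [hall] with ω hω _
    have h1 : ∑ k ∈ range K, (P[X k | 𝓕 k]) ω ≤ K * H :=
      (Finset.sum_le_sum fun k hk => (hω k hk).2).trans (by simp)
    have h2 : (K : ℝ) ≤ 4 := by exact_mod_cast hK4
    have h3 : 0 ≤ 16 * (H : ℝ) ^ 2 * Real.log (1 / δ) := by positivity
    change ∑ k ∈ range K, (P[X k | 𝓕 k]) ω ≤ _
    nlinarith
  · refine (measure_sum_condExp_le_sum_add 𝓕 hHpos X K hmeas hbdd hδ.1).trans
      (measure_mono_ae ?_)
    have hall : ∀ᵐ ω ∂P, ∀ k ∈ range K, ∑ i, Z (k + 1) ω i = H :=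
      (Finset.eventually_all _).2 fun k hk =>
        hZsum (k + 1) (by omega) (by have := Finset.mem_range.1 hk; omega)
    filter_upwards [hall] with ω hω hfreed
    have hdet := sum_sum_div_sqrt_cumulative_le (fun k => Z (k + 1) ω) H K
      fun k hk => hω k (Finset.mem_range.2 hk)
    simp_rw [← hcount] at hdet
    change 7 / 8 * ∑ k ∈ range K, (P[X k | 𝓕 k]) ω ≤
      ∑ k ∈ range K, X k ω + 4 * H * Real.log (1 / δ) at hfreed
    change ∑ k ∈ range K, X k ω ≤ _ at hdet
    have hK5 : (4 : ℝ) ≤ K := by exact_mod_cast hK4.le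
    have hlog : (8 / 7 : ℝ) ^ 2 ≤ Real.log (H * K) := by
      have h4 : Real.log 4 = 2 * Real.log 2 := by
        rw [show (4 : ℝ) = 2 ^ 2 by norm_num, Real.log_pow]; norm_num
      have hmono : Real.log 4 ≤ Real.log (H * K) :=
        Real.log_le_log (by norm_num) (by nlinarith)
      linarith [Real.log_two_gt_d9]
    have hsqrt : 8 / 7 * Real.sqrt (Fintype.card I * H * K) ≤
        Real.sqrt (Fintype.card I * H * K * Real.log (H * K)) := by
      refine Real.le_sqrt_of_sq_le ?_
      rw [mul_pow, Real.sq_sqrt (by positivity), mul_comm]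
      gcongr
    have hmain := mul_le_mul_of_nonneg_left hsqrt (by positivity : 0 ≤ 2 * Real.sqrt 2)
    have hHlog : H * Real.log (1 / δ) ≤ (H : ℝ) ^ 2 * Real.log (1 / δ) :=
      mul_le_mul_of_nonneg_right (by nlinarith) hlogδ
    have hH0 : 0 ≤ H * Real.log (1 / δ) := by positivity
    have hmH : 0 ≤ (Fintype.card I : ℝ) * H := by positivity
    change ∑ k ∈ range K, (P[X k | 𝓕 k]) ω ≤ _
    linarith
end
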